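/- There exists a linear isometric equivalence U of L²(ℝ, ℂ) (with Lebesgue measure) onto itself such that U intertwines the translation representation of ℝ with the multiplication representation: for every t ∈ ℝ and all f, g ∈ L²(ℝ, ℂ), if g coincides almost everywhere with the function s ↦ f(s − t) (where f also denotes a representative of the class f), then U g coincides almost everywhere with the function s ↦ exp(i·t·s)·(U f)(s). -/

import Mathlib

open MeasureTheory

noncomputable section

namespace SchwartzMap

open scoped SchwartzMap FourierTransform

/-- The normalized dilation `f ↦ |a|^{1/2} f(a ·)` of Schwartz functions on `ℝ`. -/
def dilation (a : ℝ) (ha : a ≠ 0) : 𝓢(ℝ, ℂ) ≃ₗ[ℂ] 𝓢(ℝ, ℂ) :=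
  let g : ℝ ≃L[ℝ] ℝ := ContinuousLinearEquiv.unitsEquivAut ℝ (Units.mk0 a ha)
  let e : 𝓢(ℝ, ℂ) ≃ₗ[ℂ] 𝓢(ℝ, ℂ) := LinearEquiv.ofLinearMap
    (compCLMOfContinuousLinearEquiv ℂ g).toLinearMap
    (compCLMOfContinuousLinearEquiv ℂ g.symm).toLinearMap
    (by ext f x; simp) (by ext f x; simp)
  e.trans (LinearEquiv.smulOfNeZero ℂ _ ((Real.sqrt |a| : ℝ) : ℂ)
    (Complex.ofReal_ne_zero.mpr (Real.sqrt_ne_zero'.mpr (abs_pos.mpr ha))))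

theorem dilation_apply (a : ℝ) (ha : a ≠ 0) (f : 𝓢(ℝ, ℂ)) (x : ℝ) :
    dilation a ha f x = (Real.sqrt |a| : ℝ) * f (a * x) := by
  simp [dilation, mul_comm x a]

theorem norm_toLp_dilation (a : ℝ) (ha : a ≠ 0) (f : 𝓢(ℝ, ℂ)) :
    ‖(dilation a ha f).toLp 2‖ = ‖f.toLp 2‖ := by
  rw [norm_toLp' two_ne_zero ENNReal.ofNat_ne_top, norm_toLp' two_ne_zero ENNReal.ofNat_ne_top]
  congr 1
  have h (x : ℝ) : ‖dilation a ha f x‖ ^ (2 : ENNReal).toReal =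
      |a| * ‖f (a * x)‖ ^ (2 : ENNReal).toReal := by
    simp [dilation_apply, mul_pow]
  simp_rw [h]
  rw [integral_const_mul, Measure.integral_comp_mul_left (fun x => ‖f x‖ ^ (2 : ENNReal).toReal),
    smul_eq_mul, ← mul_assoc, ← abs_mul, mul_inv_cancel₀ ha, abs_one, one_mul]

theorem fourier_compSubConstCLM (t : ℝ) (f : 𝓢(ℝ, ℂ)) (w : ℝ) :
    𝓕 (f.compSubConstCLM ℂ t) w = Complex.exp (-(2 * Real.pi * Complex.I * t * w)) * 𝓕 f w := by
  have h := congrFun (Fourier.fourierIntegral_comp_add_right Real.fourierChar volume f (-t)) w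
  rw [Fourier.fourierIntegral_def, Fourier.fourierIntegral_def, ← Real.fourier_real_eq,
    ← Real.fourier_real_eq, Circle.smul_def, Real.fourierChar_apply, smul_eq_mul] at h
  rw [fourier_coe, fourier_coe]
  refine h.trans ?_
  push_cast
  ring_nf

end SchwartzMap

namespace MeasureTheory.Lp

open SchwartzMap
open scoped SchwartzMap FourierTransform

/-- The unitary Fourier transform `f ↦ (2π)^{-1/2} ∫ e^{isx} f(x) dx` on `L²(ℝ)`. -/
def angularFourierₗᵢ : Lp ℂ 2 (volume : Measure ℝ) ≃ₗᵢ[ℂ] Lp ℂ 2 (volume : Measure ℝ) :=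
  ((FourierTransform.fourierEquiv ℂ 𝓢(ℝ, ℂ)).trans
    (dilation (-(2 * Real.pi)⁻¹) (by simp [Real.pi_ne_zero]))).extendOfIsometry
    (toLpCLM ℂ ℂ 2 (volume : Measure ℝ)) (toLpCLM ℂ ℂ 2 (volume : Measure ℝ))
    (denseRange_toLpCLM ENNReal.ofNat_ne_top) (denseRange_toLpCLM ENNReal.ofNat_ne_top)
    fun f => (norm_toLp_dilation _ _ _).trans (norm_fourier_toL2_eq f)

theorem angularFourierₗᵢ_toLp (f : 𝓢(ℝ, ℂ)) :
    angularFourierₗᵢ (f.toLp 2) =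
      (dilation (-(2 * Real.pi)⁻¹) (by simp [Real.pi_ne_zero]) (𝓕 f)).toLp 2 :=
  LinearEquiv.extendOfIsometry_eq _ _ _ _ _ _ f

/-- Multiplication of `L^p` functions by a continuous unimodular function. -/
def unimodularMul {α : Type*} [TopologicalSpace α] [MeasurableSpace α]
    [OpensMeasurableSpace α] {μ : Measure α} {p : ENNReal} (e : C(α, Circle))
    (f : Lp ℂ p μ) : Lp ℂ p μ :=
  MemLp.toLp (fun x => (e x : ℂ) * f x) <| (Lp.memLp f).congr_norm
    ((by fun_prop : Continuous fun x => (e x : ℂ)).aestronglyMeasurable.mul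
      (Lp.aestronglyMeasurable f)) (.of_forall fun x => by simp [Circle.norm_coe])

theorem coeFn_unimodularMul {α : Type*} [TopologicalSpace α] [MeasurableSpace α]
    [OpensMeasurableSpace α] {μ : Measure α} {p : ENNReal} (e : C(α, Circle)) (f : Lp ℂ p μ) :
    unimodularMul e f =ᵐ[μ] fun x => (e x : ℂ) * f x :=
  MemLp.coeFn_toLp _

theorem isometry_unimodularMul {α : Type*} [TopologicalSpace α] [MeasurableSpace α]
    [OpensMeasurableSpace α] {μ : Measure α} {p : ENNReal} [Fact (1 ≤ p)] (e : C(α, Circle)) :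
    Isometry (unimodularMul e : Lp ℂ p μ → Lp ℂ p μ) := by
  refine Isometry.of_dist_eq fun f g => ?_
  rw [Lp.dist_def, Lp.dist_def]
  congr 1
  refine eLpNorm_congr_norm_ae ?_
  filter_upwards [coeFn_unimodularMul e f, coeFn_unimodularMul e g] with x hf hg
  simp [hf, hg, ← mul_sub, Circle.norm_coe]

theorem angularFourierₗᵢ_translate (t : ℝ) (f : Lp ℂ 2 (volume : Measure ℝ)) :
    angularFourierₗᵢ (compMeasurePreserving (fun s => s - t)
      (measurePreserving_sub_right volume t) f) =
    unimodularMul ⟨fun s => Circle.exp (t * s), by fun_prop⟩ (angularFourierₗᵢ f) := by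
  refine DenseRange.induction_on (denseRange_toLpCLM (p := 2) ENNReal.ofNat_ne_top) f
    (isClosed_eq ?_ ?_) fun φ => ?_
  · exact angularFourierₗᵢ.continuous.comp (isometry_compMeasurePreserving _).continuous
  · exact (isometry_unimodularMul _).continuous.comp angularFourierₗᵢ.continuous
  · have h : compMeasurePreserving (fun s => s - t) (measurePreserving_sub_right volume t)
        (φ.toLp 2) = (φ.compSubConstCLM ℂ t).toLp 2 := rfl
    rw [toLpCLM_apply, h, angularFourierₗᵢ_toLp, angularFourierₗᵢ_toLp]
    refine Lp.ext ?_
    refine (coeFn_toLp _ _ _).trans (.trans ?_ (coeFn_unimodularMul _ _).symm)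
    filter_upwards [coeFn_toLp (dilation (-(2 * Real.pi)⁻¹) (by simp [Real.pi_ne_zero]) (𝓕 φ)) 2]
      with s hs
    have hpi : (Real.pi : ℂ) ≠ 0 := Complex.ofReal_ne_zero.mpr Real.pi_ne_zero
    rw [hs, dilation_apply, dilation_apply, fourier_compSubConstCLM, mul_left_comm]
    congr 1
    rw [ContinuousMap.coe_mk, Circle.coe_exp]
    congr 1
    push_cast
    field_simp

end MeasureTheory.Lp

end

/-- The multiplication representation `(ρ(t)ξ)(s) = e^{its} ξ(s)` of `ℝ` on `L²(ℝ)` is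
unitarily equivalent to the regular (translation) representation: there is a unitary
`U` of `L²(ℝ)` such that if `g = f(· − t)` a.e. then `(U g)(s) = e^{its} (U f)(s)`
a.e. -/
theorem translation_equivalent_to_multiplication :
    ∃ U : Lp ℂ 2 (volume : Measure ℝ) ≃ₗᵢ[ℂ] Lp ℂ 2 (volume : Measure ℝ),
      ∀ (t : ℝ) (f g : Lp ℂ 2 (volume : Measure ℝ)),
        (g : ℝ → ℂ) =ᵐ[volume] (fun s => f (s - t)) →
        (U g : ℝ → ℂ) =ᵐ[volume] fun s => Complex.exp (Complex.I * t * s) * U f s := by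
  refine ⟨Lp.angularFourierₗᵢ, fun t f g hg => ?_⟩
  have h : g = Lp.compMeasurePreserving (fun s => s - t)
      (measurePreserving_sub_right volume t) f :=
    Lp.ext (hg.trans (Lp.coeFn_compMeasurePreserving f _).symm)
  rw [h, Lp.angularFourierₗᵢ_translate]
  filter_upwards [Lp.coeFn_unimodularMul _ _] with s hs
  rw [hs, ContinuousMap.coe_mk, Circle.coe_exp]
  push_cast
  ring_nf
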